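/- For every n ≥ 1 and every k with 0 ≤ k ≤ n-1, the union ⋃_{x ∈ ψ k n ∪ ω k n} geom x (with the subspace topology from Fin n → ℝ) is homeomorphic to the unit sphere Metric.sphere (0 : EuclideanSpace ℝ (Fin (k+1))) 1; i.e., the source and target k-faces together form a k-dimensional sphere splitting into the two hemispheres ψ k n and ω k n. -/

import Mathlib

/-- The geometric realization of a sub-cube word `x : Fin n → SignType`
as a face of the cube `[-1,1]^n ⊆ (Fin n → ℝ)`. -/
def geom {n : ℕ} (x : Fin n → SignType) : Set (Fin n → ℝ) :=
  {p | ∀ i, (x i = 0 → p i ∈ Set.Icc (-1 : ℝ) 1) ∧ (x i ≠ 0 → p i = (x i : ℝ))}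

/-- The dimension of a sub-cube: the number of `0` letters. -/
def dim {n : ℕ} (x : Fin n → SignType) : ℕ :=
  (Finset.univ.filter fun i => x i = 0).card

/-- The zero-set of a word. -/
def zeroSet {n : ℕ} (x : Fin n → SignType) : Finset (Fin n) :=
  Finset.univ.filter fun i => x i = 0

/-- Append the letter `s` at the end of a word (`λ`, `μ`, `ν` are `app (-1)`, `app 0`, `app 1`). -/
def app {n : ℕ} (s : SignType) (x : Fin n → SignType) : Fin (n + 1) → SignType :=
  Fin.snoc x s

/-- The source `k`-faces `ψ k n` of the `n`-cube. -/
def Psi : (k n : ℕ) → Finset (Fin n → SignType)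
  | _, 0 => {fun i => i.elim0}
  | 0, _ + 1 => {fun _ => -1}
  | k + 1, n + 1 =>
    if n + 1 ≤ k + 1 then {fun _ => 0}
    else if Even (k + 1) then
      (Psi k n).image (app 0) ∪ (Psi (k + 1) n).image (app (-1))
    else
      (Psi k n).image (app 0) ∪ (Psi (k + 1) n).image (app 1)

/-- The target `k`-faces `ω k n` of the `n`-cube. -/
def Omega : (k n : ℕ) → Finset (Fin n → SignType)
  | _, 0 => {fun i => i.elim0}
  | 0, _ + 1 => {fun _ => 1}
  | k + 1, n + 1 =>
    if n + 1 ≤ k + 1 then {fun _ => 0}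
    else if Even (k + 1) then
      (Omega (k + 1) n).image (app 1) ∪ (Omega k n).image (app 0)
    else
      (Omega (k + 1) n).image (app (-1)) ∪ (Omega k n).image (app 0)

open Polynomial

theorem Psi_zero (n : ℕ) : Psi 0 n = {fun _ => -1} := by
  cases n with
  | zero => exact congrArg _ (Subsingleton.elim _ _)
  | succ n => rfl

theorem Psi_self (n : ℕ) : Psi n n = {fun _ => 0} := by
  cases n with
  | zero => exact congrArg _ (Subsingleton.elim _ _)
  | succ n => simp [Psi]

theorem Psi_succ_succ {k n : ℕ} (h : k + 1 ≤ n) :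
    Psi (k + 1) (n + 1) =
      (Psi k n).image (app 0) ∪ (Psi (k + 1) n).image (app ((-1) ^ k)) := by
  rw [Psi, if_neg (by omega)]
  rcases Nat.even_or_odd k with hk | hk
  · rw [if_neg (by grind), hk.neg_one_pow]
  · rw [if_pos (by grind), hk.neg_one_pow]

theorem neg_app {n : ℕ} (s : SignType) (x : Fin n → SignType) : -app s x = app (-s) (-x) := by
  ext i
  refine Fin.lastCases ?_ (fun i => ?_) i <;> simp [app]

theorem image_neg_image_app {n : ℕ} (s : SignType) (A : Finset (Fin n → SignType)) :
    (A.image (app s)).image (-·) = (A.image (-·)).image (app (-s)) := by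
  simp only [Finset.image_image, Function.comp_def, neg_app]

theorem image_neg_Psi (k n : ℕ) : (Psi k n).image (-·) = Omega k n := by
  induction n generalizing k with
  | zero =>
    cases k <;> simp only [Psi, Omega, Finset.image_singleton] <;>
      exact congrArg _ (Subsingleton.elim _ _)
  | succ n ih =>
    cases k with
    | zero => simp [Psi, Omega]; rfl
    | succ k =>
      simp only [Psi, Omega]
      split_ifs
      · simp; rfl
      · rw [Finset.image_union, image_neg_image_app, image_neg_image_app, ih, ih, neg_zero,
          neg_neg, Finset.union_comm]
      · rw [Finset.image_union, image_neg_image_app, image_neg_image_app, ih, ih, neg_zero,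
          Finset.union_comm]

theorem mem_Omega_iff {k n : ℕ} {x : Fin n → SignType} : x ∈ Omega k n ↔ -x ∈ Psi k n := by
  rw [← image_neg_Psi]
  simp only [Finset.mem_image]
  exact ⟨fun ⟨y, hy, h⟩ => h ▸ (neg_neg y).symm ▸ hy, fun h => ⟨_, h, neg_neg x⟩⟩

/-- A source face records the signs at the nodes `0, …, n - 1` of a polynomial of degree at most
`k`, whose sign beyond the last node is `(-1) ^ (k + 1)`. -/
theorem exists_polynomial_of_mem_Psi {k n : ℕ} (hkn : k ≤ n) {x : Fin n → SignType}
    (hx : x ∈ Psi k n) :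
    ∃ Q : ℝ[X], Q.natDegree ≤ k ∧ (∀ i : Fin n, SignType.sign (Q.eval (i : ℝ)) = x i) ∧
      ∀ m : ℝ, (n : ℝ) ≤ m → SignType.sign (Q.eval m) = (-1) ^ (k + 1) := by
  induction n generalizing k with
  | zero =>
    obtain rfl : k = 0 := by omega
    exact ⟨-1, by simp, fun i => i.elim0, fun m _ => by simp⟩
  | succ n ih =>
    cases k with
    | zero =>
      rw [Psi_zero, Finset.mem_singleton] at hx
      exact ⟨-1, by simp, fun i => by simp [hx], fun m _ => by simp⟩
    | succ k =>
      have extend_zero : ∀ y ∈ Psi k n, ∃ Q : ℝ[X], Q.natDegree ≤ k + 1 ∧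
          (∀ i : Fin (n + 1), SignType.sign (Q.eval (i : ℝ)) = app 0 y i) ∧
          ∀ m : ℝ, ((n + 1 : ℕ) : ℝ) ≤ m → SignType.sign (Q.eval m) = (-1) ^ (k + 1 + 1) := by
        intro y hy
        obtain ⟨Q, hdeg, hQ, hlast⟩ := ih (by omega) hy
        refine ⟨Q * (C (n : ℝ) - X), ?_, fun i => ?_, fun m hm => ?_⟩
        · refine natDegree_mul_le.trans (add_le_add hdeg ?_)
          exact (natDegree_sub_le _ _).trans (by simp)
        · refine Fin.lastCases ?_ (fun i => ?_) i
          · simp [app]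
          · have : (0 : ℝ) < n - i := sub_pos.2 (by exact_mod_cast i.2)
            simp [app, sign_mul, sign_pos this, hQ]
        · push_cast at hm
          have : (n : ℝ) - m < 0 := by linarith
          rw [eval_mul, sign_mul, hlast m (by linarith)]
          simp [sign_neg this, pow_succ]
      rcases Nat.lt_or_ge k n with h | h
      · rw [Psi_succ_succ h, Finset.mem_union, Finset.mem_image, Finset.mem_image] at hx
        rcases hx with ⟨y, hy, rfl⟩ | ⟨y, hy, rfl⟩
        · exact extend_zero y hy
        · obtain ⟨Q, hdeg, hQ, hlast⟩ := ih h hy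
          refine ⟨Q, hdeg, fun i => ?_, fun m hm => hlast m ?_⟩
          · refine Fin.lastCases ?_ (fun i => ?_) i
            · simp [app, hlast, pow_succ]
            · simp [app, hQ]
          · push_cast at hm; linarith
      · obtain rfl : k = n := by omega
        rw [Psi_self, Finset.mem_singleton] at hx
        subst hx
        have h0 : (fun _ => 0 : Fin (k + 1) → SignType) = app 0 (fun _ => 0) := by
          ext i
          refine Fin.lastCases ?_ (fun i => ?_) i <;> simp [app]
        rw [h0]
        exact extend_zero _ (by simp [Psi_self])

theorem exists_polynomial_of_mem_union {k n : ℕ} (hkn : k ≤ n) {x : Fin n → SignType}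
    (hx : x ∈ Psi k n ∪ Omega k n) :
    ∃ Q : ℝ[X], Q ≠ 0 ∧ Q.natDegree ≤ k ∧ ∀ i : Fin n, SignType.sign (Q.eval (i : ℝ)) = x i := by
  have main : ∀ y ∈ Psi k n, ∃ Q : ℝ[X], Q ≠ 0 ∧ Q.natDegree ≤ k ∧
      ∀ i : Fin n, SignType.sign (Q.eval (i : ℝ)) = y i := by
    intro y hy
    obtain ⟨Q, hdeg, hQ, hlast⟩ := exists_polynomial_of_mem_Psi hkn hy
    refine ⟨Q, ?_, hdeg, hQ⟩
    rintro rfl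
    simpa using (hlast n le_rfl).symm
  rcases Finset.mem_union.1 hx with hx | hx
  · exact main x hx
  · obtain ⟨Q, hQ0, hdeg, hQ⟩ := main _ (mem_Omega_iff.1 hx)
    exact ⟨-Q, neg_ne_zero.2 hQ0, by simpa, fun i => by simp [Left.sign_neg, hQ]⟩

theorem neg_mem_union {k n : ℕ} {x : Fin n → SignType} (hx : x ∈ Psi k n ∪ Omega k n) :
    -x ∈ Psi k n ∪ Omega k n := by
  simp only [Finset.mem_union, mem_Omega_iff, neg_neg] at hx ⊢
  exact hx.symm

theorem app_zero_mem_union {k n : ℕ} (h : k + 1 ≤ n) {x : Fin n → SignType}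
    (hx : x ∈ Psi k n ∪ Omega k n) : app 0 x ∈ Psi (k + 1) (n + 1) ∪ Omega (k + 1) (n + 1) := by
  simp only [Finset.mem_union, mem_Omega_iff, neg_app, neg_zero] at hx ⊢
  rw [Psi_succ_succ h]
  exact hx.imp (fun hx => Finset.mem_union_left _ (Finset.mem_image_of_mem _ hx))
    (fun hx => Finset.mem_union_left _ (Finset.mem_image_of_mem _ hx))

/-- A nonzero polynomial has a value of nonzero sign at one of any `n > natDegree` nodes. -/
theorem exists_eval_ne_zero {n : ℕ} {P : ℝ[X]} (hP : P ≠ 0) (hdeg : P.natDegree < n) :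
    ∃ i : Fin n, P.eval (i : ℝ) ≠ 0 := by
  by_contra! h
  refine hP (eq_zero_of_natDegree_lt_card_of_eval_eq_zero P (f := fun i : Fin n => (i : ℝ))
    (Nat.cast_injective.comp Fin.val_injective) h (by simpa))

/-- If `R` vanishes at the node `n`, dividing by `n - X` preserves all signs to the left of `n`. -/
theorem exists_natDegree_le_sign_eq {k n : ℕ} {R : ℝ[X]} (hR : R ≠ 0) (hdeg : R.natDegree ≤ k + 1)
    (hroot : R.eval (n : ℝ) = 0) :
    ∃ Q : ℝ[X], Q ≠ 0 ∧ Q.natDegree ≤ k ∧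
      ∀ i : Fin n, SignType.sign (Q.eval (i : ℝ)) = SignType.sign (R.eval (i : ℝ)) := by
  obtain ⟨Q, rfl⟩ := dvd_iff_isRoot.2 hroot
  have hQ : Q ≠ 0 := right_ne_zero_of_mul hR
  refine ⟨-Q, neg_ne_zero.2 hQ, ?_, fun i => ?_⟩
  · rw [natDegree_mul (X_sub_C_ne_zero _) hQ, natDegree_X_sub_C] at hdeg
    rw [natDegree_neg]
    omega
  · have : (i : ℝ) - n < 0 := sub_neg.2 (by exact_mod_cast i.2)
    simp [sign_mul, sign_neg this, Left.sign_neg]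

/-- The signs of a nonzero polynomial of degree at most `k` at the nodes `0, …, n - 1` refine a
source or target `k`-face. -/
theorem exists_mem_union_of_polynomial {k n : ℕ} (hkn : k ≤ n) {P : ℝ[X]} (hP : P ≠ 0)
    (hdeg : P.natDegree ≤ k) :
    ∃ x ∈ Psi k n ∪ Omega k n, ∀ i : Fin n, x i ≠ 0 → SignType.sign (P.eval (i : ℝ)) = x i := by
  induction n generalizing k P with
  | zero =>
    obtain rfl : k = 0 := by omega
    exact ⟨fun _ => -1, by simp [Psi_zero], fun i => i.elim0⟩
  | succ n ih =>
    rcases hkn.eq_or_lt with rfl | hkn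
    · exact ⟨fun _ => 0, by simp [Psi_self], fun i h => (h rfl).elim⟩
    cases k with
    | zero =>
      have hconst := eq_C_of_natDegree_le_zero hdeg
      have hc : P.coeff 0 ≠ 0 := fun h => hP (by rw [hconst, h, C_0])
      refine ⟨fun _ => SignType.sign (P.coeff 0), ?_, fun i _ => by rw [hconst]; simp⟩
      rcases lt_or_gt_of_ne hc with h | h
      · simp [sign_neg h, Psi_zero]
      · simp [sign_pos h, Omega]
    | succ k =>
      have hkn' : k + 1 ≤ n := by omega
      have extend_zero : ∀ R : ℝ[X], R ≠ 0 → R.natDegree ≤ k + 1 → R.eval (n : ℝ) = 0 →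
          ∃ x ∈ Psi (k + 1) (n + 1) ∪ Omega (k + 1) (n + 1),
            ∀ i : Fin (n + 1), x i ≠ 0 → SignType.sign (R.eval (i : ℝ)) = x i := by
        intro R hR hdegR hroot
        obtain ⟨Q, hQ, hdegQ, hsign⟩ := exists_natDegree_le_sign_eq hR hdegR hroot
        obtain ⟨y, hy, hyQ⟩ := ih (by omega) hQ hdegQ
        refine ⟨app 0 y, app_zero_mem_union hkn' hy, fun i => ?_⟩
        refine Fin.lastCases ?_ (fun i hi => ?_) i
        · simp [app]
        · simp only [app, Fin.snoc_castSucc, Fin.val_castSucc] at hi ⊢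
          rw [← hsign, hyQ i hi]
      have main : ∀ R : ℝ[X], R ≠ 0 → R.natDegree ≤ k + 1 → ∀ y ∈ Psi (k + 1) n,
          (∀ i : Fin n, y i ≠ 0 → SignType.sign (R.eval (i : ℝ)) = y i) →
          ∃ x ∈ Psi (k + 1) (n + 1) ∪ Omega (k + 1) (n + 1),
            ∀ i : Fin (n + 1), x i ≠ 0 → SignType.sign (R.eval (i : ℝ)) = x i := by
        intro R hR hdegR y hy hyR
        by_cases hroot : R.eval (n : ℝ) = 0
        · exact extend_zero R hR hdegR hroot
        by_cases hlast : SignType.sign (R.eval (n : ℝ)) = (-1) ^ k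
        · refine ⟨app ((-1) ^ k) y, Finset.mem_union_left _ ?_, fun i => ?_⟩
          · rw [Psi_succ_succ hkn']
            exact Finset.mem_union_right _ (Finset.mem_image_of_mem _ hy)
          · refine Fin.lastCases ?_ (fun i hi => ?_) i
            · simp [app, hlast]
            · simp only [app, Fin.snoc_castSucc, Fin.val_castSucc] at hi ⊢
              exact hyR i hi
        rcases hkn'.eq_or_lt with rfl | hlt
        · refine ⟨app (-(-1) ^ k) 0, Finset.mem_union_right _ ?_, fun i => ?_⟩
          · rw [mem_Omega_iff, neg_app, Psi_succ_succ le_rfl]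
            refine Finset.mem_union_right _ (Finset.mem_image.2 ⟨0, ?_, by simp⟩)
            rw [Psi_self]
            exact Finset.mem_singleton_self _
          · refine Fin.lastCases (fun _ => ?_) (fun i hi => ?_) i
            · simp only [app, Fin.snoc_last, Fin.val_last]
              have h0 : SignType.sign (R.eval ((k + 1 : ℕ) : ℝ)) ≠ 0 := by simpa using hroot
              revert hlast h0
              generalize SignType.sign (R.eval ((k + 1 : ℕ) : ℝ)) = s
              rcases neg_one_pow_eq_or SignType k with h | h <;> rw [h] <;> revert s <;> decide
            · simp [app] at hi
        · obtain ⟨Q, hdegQ, hQ, hQlast⟩ := exists_polynomial_of_mem_Psi hkn' hy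
          specialize hQlast n le_rfl
          set a := R.eval (n : ℝ) with ha
          set b := Q.eval (n : ℝ) with hb
          have hab : a * b < 0 := by
            rw [← sign_eq_neg_one_iff, sign_mul, hQlast]
            have h0 : SignType.sign a ≠ 0 := by simpa using hroot
            revert hlast h0
            generalize SignType.sign a = s
            rw [pow_succ, pow_succ]
            rcases neg_one_pow_eq_or SignType k with h | h <;> rw [h] <;> revert s <;> decide
          let S : ℝ[X] := C (b ^ 2) * R - C (a * b) * Q
          have hb0 : 0 < b ^ 2 := by
            have : b ≠ 0 := by rintro h; simp [h] at hab
            positivity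
          have hS : ∀ i : Fin n, SignType.sign (S.eval (i : ℝ)) =
              SignType.sign (R.eval (i : ℝ)) := by
            intro i
            have hi : SignType.sign (Q.eval (i : ℝ)) ≠ 0 →
                SignType.sign (R.eval (i : ℝ)) = SignType.sign (Q.eval (i : ℝ)) := by
              rw [hQ i]; exact hyR i
            simp only [S, eval_sub, eval_mul, eval_C]
            rcases lt_trichotomy (Q.eval (i : ℝ)) 0 with h | h | h
            · have h' := hi (by simpa using h.ne)
              rw [sign_neg h, sign_eq_neg_one_iff] at h'
              rw [sign_neg h', sign_neg]
              nlinarith [mul_pos_of_neg_of_neg hab h, mul_neg_of_pos_of_neg hb0 h']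
            · rw [h, mul_zero, sub_zero, sign_mul, sign_pos hb0, one_mul]
            · have h' := hi (by simpa using h.ne')
              rw [sign_pos h, sign_eq_one_iff] at h'
              rw [sign_pos h', sign_pos]
              nlinarith [mul_neg_of_neg_of_pos hab h, mul_pos hb0 h']
          have hS0 : S ≠ 0 := by
            intro h
            obtain ⟨i, hi⟩ := exists_eval_ne_zero hR (hdegR.trans_lt hlt)
            exact hi (by simpa [h] using (hS i).symm)
          have hSroot : S.eval (n : ℝ) = 0 := by
            simp only [S, eval_sub, eval_mul, eval_C, ← ha, ← hb]; ring
          have hSdeg : S.natDegree ≤ k + 1 :=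
            (natDegree_sub_le _ _).trans (max_le ((natDegree_C_mul_le _ _).trans hdegR)
              ((natDegree_C_mul_le _ _).trans hdegQ))
          obtain ⟨T, hT0, hTdeg, hT⟩ := exists_natDegree_le_sign_eq hS0 hSdeg hSroot
          obtain ⟨z, hz, hzT⟩ := ih (by omega) hT0 hTdeg
          refine ⟨app 0 z, app_zero_mem_union hkn' hz, fun i => ?_⟩
          refine Fin.lastCases ?_ (fun i hi => ?_) i
          · simp [app]
          · simp only [app, Fin.snoc_castSucc, Fin.val_castSucc] at hi ⊢
            rw [← hS, ← hT, hzT i hi]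
      obtain ⟨y, hy, hyP⟩ := ih hkn' hP hdeg
      rcases Finset.mem_union.1 hy with hy | hy
      · exact main P hP hdeg y hy hyP
      · obtain ⟨x, hx, hxP⟩ := main (-P) (neg_ne_zero.2 hP) (by simpa) (-y) (mem_Omega_iff.1 hy)
          (fun i hi => by simpa [Left.sign_neg] using hyP i (by simpa using hi))
        refine ⟨-x, neg_mem_union hx, fun i hi => ?_⟩
        have := hxP i (by simpa using hi)
        rw [Pi.neg_apply, ← this, eval_neg, Left.sign_neg, neg_neg]

theorem mem_iUnion_geom_iff {k n : ℕ} (hkn : k ≤ n) {p : Fin n → ℝ} :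
    p ∈ ⋃ x ∈ Psi k n ∪ Omega k n, geom x ↔
      p ∈ Set.Icc (-1 : Fin n → ℝ) 1 ∧ ∃ P : ℝ[X], P ≠ 0 ∧ P.natDegree ≤ k ∧
        ∀ i : Fin n, P.eval (i : ℝ) ≠ 0 → p i = SignType.sign (P.eval (i : ℝ)) := by
  simp only [Set.mem_iUnion, exists_prop]
  constructor
  · rintro ⟨x, hx, hp⟩
    have hbox : ∀ i, p i ∈ Set.Icc (-1 : ℝ) 1 := by
      intro i
      by_cases h : x i = 0
      · exact (hp i).1 h
      · rw [(hp i).2 h]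
        rcases SignType.trichotomy (x i) with h | h | h <;> simp [h]
    obtain ⟨P, hP, hdeg, hsign⟩ := exists_polynomial_of_mem_union hkn hx
    refine ⟨⟨fun i => (hbox i).1, fun i => (hbox i).2⟩, P, hP, hdeg, fun i hi => ?_⟩
    rw [hsign]
    exact (hp i).2 (by rwa [← hsign, sign_ne_zero])
  · rintro ⟨hbox, P, hP, hdeg, hsign⟩
    obtain ⟨x, hx, hxP⟩ := exists_mem_union_of_polynomial hkn hP hdeg
    refine ⟨x, hx, fun i => ⟨fun _ => ⟨hbox.1 i, hbox.2 i⟩, fun hi => ?_⟩⟩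
    rw [← hxP i hi]
    exact hsign i (by rwa [← sign_ne_zero, hxP i hi])

/-- The linear projection sending the `i`-th basis vector to the point `(1, i, …, i ^ k)` of the
moment curve; it maps the cube onto a cyclic zonotope. -/
def momentMap (k n : ℕ) : (Fin n → ℝ) →ₗ[ℝ] EuclideanSpace ℝ (Fin (k + 1)) where
  toFun p := WithLp.toLp 2 fun j => ∑ i : Fin n, p i * (i : ℝ) ^ (j : ℕ)
  map_add' p q := by ext j; simp [add_mul, Finset.sum_add_distrib]
  map_smul' c p := by ext j; simp [mul_assoc, Finset.mul_sum]

theorem sum_coeff_mul_momentMap {k n : ℕ} {P : ℝ[X]} (hdeg : P.natDegree ≤ k) (p : Fin n → ℝ) :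
    ∑ j : Fin (k + 1), P.coeff j * momentMap k n p j = ∑ i : Fin n, p i * P.eval (i : ℝ) := by
  simp only [momentMap, LinearMap.coe_mk, AddHom.coe_mk, Finset.mul_sum]
  rw [Finset.sum_comm]
  refine Finset.sum_congr rfl fun i _ => ?_
  rw [eval_eq_sum_range' (Nat.lt_succ_of_le hdeg), Finset.mul_sum, ← Fin.sum_univ_eq_sum_range
    (fun j => p i * (P.coeff j * (i : ℝ) ^ j))]
  exact Finset.sum_congr rfl fun j _ => by ring

/-- Linear functionals composed with `momentMap` are given by evaluating polynomials. -/
theorem exists_polynomial_of_dual {k n : ℕ} (f : EuclideanSpace ℝ (Fin (k + 1)) →ₗ[ℝ] ℝ)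
    (hf : f ≠ 0) :
    ∃ P : ℝ[X], P ≠ 0 ∧ P.natDegree ≤ k ∧
      ∀ p : Fin n → ℝ, f (momentMap k n p) = ∑ i : Fin n, p i * P.eval (i : ℝ) := by
  classical
  let c : Fin (k + 1) → ℝ := fun j => f (EuclideanSpace.single j 1)
  have hf_apply : ∀ v, f v = ∑ j, c j * v j := by
    intro v
    conv_lhs => rw [← (EuclideanSpace.basisFun (Fin (k + 1)) ℝ).sum_repr v]
    simp [c, mul_comm]
  let P : ℝ[X] := ∑ j : Fin (k + 1), monomial (j : ℕ) (c j)
  have hcoeff : ∀ j : Fin (k + 1), P.coeff j = c j := by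
    intro j
    simp [P, coeff_monomial, Fin.val_inj]
  have hdeg : P.natDegree ≤ k :=
    natDegree_sum_le_of_forall_le _ _ fun j _ =>
      (natDegree_monomial_le _).trans (Nat.lt_succ_iff.1 j.2)
  refine ⟨P, fun hP => hf ?_, hdeg, fun p => ?_⟩
  · ext v
    simp [hf_apply, ← hcoeff, hP]
  · rw [hf_apply, ← sum_coeff_mul_momentMap hdeg]
    simp only [hcoeff]

theorem momentMap_surjective {k n : ℕ} (h : k < n) : Function.Surjective (momentMap k n) := by
  rw [← LinearMap.range_eq_top]
  by_contra hlt
  obtain ⟨f, hf, hle⟩ := Submodule.exists_le_ker_of_lt_top _ (lt_top_iff_ne_top.2 hlt)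
  obtain ⟨P, hP, hdeg, hfP⟩ := exists_polynomial_of_dual (n := n) f hf
  obtain ⟨i, hi⟩ := exists_eval_ne_zero hP (hdeg.trans_lt h)
  have := hfP (Pi.single i 1)
  rw [hle (LinearMap.mem_range_self _ _)] at this
  simp [Pi.single_apply] at this
  exact hi this.symm

/-- Any `k + 1` points of the moment curve are linearly independent. -/
theorem eq_zero_of_momentMap_eq_zero {k n : ℕ} {d : Fin n → ℝ} (hd : momentMap k n d = 0)
    {P : ℝ[X]} (hP : P ≠ 0) (hdeg : P.natDegree ≤ k)
    (hsupp : ∀ i : Fin n, P.eval (i : ℝ) ≠ 0 → d i = 0) : d = 0 := by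
  classical
  by_contra hne
  obtain ⟨i, hi⟩ := Function.ne_iff.1 hne
  let Z : Finset (Fin n) := Finset.univ.filter fun j => P.eval (j : ℝ) = 0
  have hinj : Function.Injective fun j : Fin n => (j : ℝ) :=
    Nat.cast_injective.comp Fin.val_injective
  have hZ : Z.card ≤ k := by
    rw [← Finset.card_image_of_injective Z hinj]
    refine (card_le_degree_of_subset_roots fun r hr => ?_).trans hdeg
    obtain ⟨j, hj, rfl⟩ := Finset.mem_image.1 (Finset.mem_val ▸ hr)
    exact (mem_roots hP).2 (Finset.mem_filter.1 hj).2
  let R : ℝ[X] := ∏ j ∈ Z.erase i, (X - C (j : ℝ))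
  have hR : R.natDegree ≤ k := by
    rw [natDegree_prod_of_monic _ _ fun j _ => monic_X_sub_C _]
    simp only [natDegree_X_sub_C, Finset.sum_const, smul_eq_mul, mul_one]
    exact (Finset.card_le_card (Z.erase_subset i)).trans hZ
  have hsum := sum_coeff_mul_momentMap hR d
  rw [Finset.sum_eq_single i] at hsum
  · simp only [hd, PiLp.zero_apply, mul_zero, Finset.sum_const_zero] at hsum
    refine mul_ne_zero hi ?_ hsum.symm
    simp only [R, eval_prod, eval_sub, eval_X, eval_C, Finset.prod_ne_zero_iff]
    exact fun j hj => sub_ne_zero.2 (hinj.ne (Finset.ne_of_mem_erase hj).symm)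
  · intro j _ hji
    by_cases hj : P.eval (j : ℝ) = 0
    · have : R.eval (j : ℝ) = 0 := by
        simp only [R, eval_prod]
        exact Finset.prod_eq_zero (i := j) (by simp [Z, hji, hj]) (by simp)
      rw [this, mul_zero]
    · rw [hsupp j hj, zero_mul]
  · simp

theorem mul_le_sign_mul {q a : ℝ} (hq : |q| ≤ 1) : q * a ≤ SignType.sign a * a := by
  rw [sign_mul_self]
  calc q * a ≤ |q * a| := le_abs_self _
    _ = |q| * |a| := abs_mul _ _
    _ ≤ |a| := mul_le_of_le_one_left (abs_nonneg a) hq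

theorem abs_le_one_of_mem_Icc {n : ℕ} {q : Fin n → ℝ} (hq : q ∈ Set.Icc (-1 : Fin n → ℝ) 1)
    (i : Fin n) : |q i| ≤ 1 :=
  abs_le.2 ⟨hq.1 i, hq.2 i⟩

theorem mul_eval_le {n : ℕ} {p q : Fin n → ℝ} {P : ℝ[X]}
    (hp : ∀ i : Fin n, P.eval (i : ℝ) ≠ 0 → p i = SignType.sign (P.eval (i : ℝ)))
    (hq : q ∈ Set.Icc (-1 : Fin n → ℝ) 1) (i : Fin n) :
    q i * P.eval (i : ℝ) ≤ p i * P.eval (i : ℝ) := by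
  by_cases h : P.eval (i : ℝ) = 0
  · simp [h]
  · rw [hp i h]
    exact mul_le_sign_mul (abs_le_one_of_mem_Icc hq i)

theorem injOn_momentMap {k n : ℕ} (hkn : k ≤ n) :
    Set.InjOn (momentMap k n) (⋃ x ∈ Psi k n ∪ Omega k n, geom x) := by
  intro p hp q hq hpq
  obtain ⟨-, P, hP, hdeg, hsign⟩ := (mem_iUnion_geom_iff hkn).1 hp
  obtain ⟨hqbox, -⟩ := (mem_iUnion_geom_iff hkn).1 hq
  have hsum : ∑ i, q i * P.eval (i : ℝ) = ∑ i, p i * P.eval (i : ℝ) := by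
    rw [← sum_coeff_mul_momentMap hdeg, ← sum_coeff_mul_momentMap hdeg, hpq]
  have hterm := (Finset.sum_eq_sum_iff_of_le fun i _ => mul_eval_le hsign hqbox i).1 hsum
  refine sub_eq_zero.1 (eq_zero_of_momentMap_eq_zero (by rw [map_sub, hpq, sub_self]) hP hdeg
    fun i hi => ?_)
  rw [Pi.sub_apply, mul_right_cancel₀ hi (hterm i (Finset.mem_univ i)), sub_self]

theorem isCompact_momentMap_image (k n : ℕ) :
    IsCompact (momentMap k n '' Set.Icc (-1) 1) :=
  isCompact_Icc.image (momentMap k n).continuous_of_finiteDimensional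

theorem interior_momentMap_image_nonempty {k n : ℕ} (h : k < n) :
    (interior (momentMap k n '' Set.Icc (-1) 1)).Nonempty := by
  have hopen := (momentMap k n).isOpenMap_of_finiteDimensional (momentMap_surjective h)
  have hne : (interior (Set.Icc (-1 : Fin n → ℝ) 1)).Nonempty := by
    refine ⟨0, mem_interior.2 ⟨Set.univ.pi fun _ => Set.Ioo (-1) 1, fun q hq => ?_,
      isOpen_set_pi Set.finite_univ fun _ _ => isOpen_Ioo, by simp⟩⟩
    exact ⟨fun i => (hq i trivial).1.le, fun i => (hq i trivial).2.le⟩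
  exact (hne.image _).mono (hopen.image_interior_subset _)

theorem momentMap_image_iUnion_geom {k n : ℕ} (h : k < n) :
    momentMap k n '' (⋃ x ∈ Psi k n ∪ Omega k n, geom x) =
      frontier (momentMap k n '' Set.Icc (-1) 1) := by
  classical
  rw [(isCompact_momentMap_image k n).isClosed.frontier_eq]
  ext z
  constructor
  · rintro ⟨p, hp, rfl⟩
    obtain ⟨hbox, P, hP, hdeg, hsign⟩ := (mem_iUnion_geom_iff h.le).1 hp
    refine ⟨Set.mem_image_of_mem _ hbox, fun hint => ?_⟩
    obtain ⟨i, hi⟩ := exists_eval_ne_zero hP (hdeg.trans_lt h)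
    let f : EuclideanSpace ℝ (Fin (k + 1)) →ₗ[ℝ] ℝ :=
      ∑ j : Fin (k + 1), P.coeff j • (EuclideanSpace.proj j).toLinearMap
    have hf : ∀ q, f (momentMap k n q) = ∑ i, q i * P.eval (i : ℝ) := by
      intro q
      rw [← sum_coeff_mul_momentMap hdeg]
      simp [f]
    have hf0 : f.toContinuousLinearMap ≠ 0 := by
      intro h0
      have h1 : f (momentMap k n (Pi.single i 1)) = 0 := DFunLike.congr_fun h0 _
      rw [hf] at h1
      simp [Pi.single_apply] at h1
      exact hi h1
    have hsub : f '' interior (momentMap k n '' Set.Icc (-1) 1) ⊆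
        Set.Iic (f (momentMap k n p)) := by
      rintro - ⟨w, hw, rfl⟩
      obtain ⟨q, hq, rfl⟩ := interior_subset hw
      rw [Set.mem_Iic, hf, hf]
      exact Finset.sum_le_sum fun i _ => mul_eval_le hsign hq i
    have := interior_maximal hsub
      (f.toContinuousLinearMap.isOpenMap_of_ne_zero hf0 _ isOpen_interior)
      (Set.mem_image_of_mem f hint)
    rw [interior_Iic] at this
    exact lt_irrefl _ (Set.mem_Iio.1 this)
  · rintro ⟨⟨p, hp, rfl⟩, hint⟩
    refine Set.mem_image_of_mem _ ((mem_iUnion_geom_iff h.le).2 ⟨hp, ?_⟩)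
    obtain ⟨f, hf0, hf⟩ := geometric_hahn_banach_of_nonempty_interior_point
      ((convex_Icc _ _).linear_image _) hint (interior_momentMap_image_nonempty h)
    obtain ⟨P, hP, hdeg, hfP⟩ := exists_polynomial_of_dual (n := n) f.toLinearMap
      fun h0 => hf0 (ContinuousLinearMap.coe_injective h0)
    refine ⟨P, hP, hdeg, fun i hi => mul_right_cancel₀ hi (le_antisymm
      (mul_le_sign_mul (abs_le_one_of_mem_Icc hp i)) ?_)⟩
    let q : Fin n → ℝ := Function.update p i (SignType.sign (P.eval (i : ℝ)))
    have hq : q ∈ Set.Icc (-1 : Fin n → ℝ) 1 := by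
      have : ∀ j, |q j| ≤ 1 := by
        intro j
        rcases eq_or_ne j i with rfl | hj
        · rcases lt_or_gt_of_ne hi with h | h <;> simp [q, h]
        · simpa [q, hj] using abs_le_one_of_mem_Icc hp j
      exact ⟨fun j => (abs_le.1 (this j)).1, fun j => (abs_le.1 (this j)).2⟩
    have hle := hf _ (Set.mem_image_of_mem _ hq)
    have hle' : ∑ j, q j * P.eval (j : ℝ) ≤ ∑ j, p j * P.eval (j : ℝ) := by
      rw [← hfP, ← hfP]; exact hle
    rw [← Finset.add_sum_erase _ _ (Finset.mem_univ i),
      ← Finset.add_sum_erase _ (fun j => p j * _) (Finset.mem_univ i)] at hle'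
    have herase : ∑ j ∈ Finset.univ.erase i, q j * P.eval (j : ℝ) =
        ∑ j ∈ Finset.univ.erase i, p j * P.eval (j : ℝ) :=
      Finset.sum_congr rfl fun j hj => by simp [q, Finset.ne_of_mem_erase hj]
    rw [herase, add_le_add_iff_right] at hle'
    simpa only [q, Function.update_self] using hle'

theorem isCompact_geom {n : ℕ} (x : Fin n → SignType) : IsCompact (geom x) := by
  have : geom x = Set.univ.pi fun i => if x i = 0 then Set.Icc (-1 : ℝ) 1 else {(x i : ℝ)} := by
    ext p
    refine ⟨fun hp i _ => ?_, fun hp i => ?_⟩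
    · by_cases h : x i = 0
      · simpa [h] using (hp i).1 h
      · simpa [h] using (hp i).2 h
    · have := hp i trivial
      constructor <;> intro h <;> simpa [h] using this
  rw [this]
  refine isCompact_univ_pi fun i => ?_
  split_ifs
  exacts [isCompact_Icc, isCompact_singleton]

/-- The source and target `k`-faces together form a `k`-dimensional sphere. -/
theorem stmt_6 (n k : ℕ) (hn : 1 ≤ n) (hk : k ≤ n - 1) :
    Nonempty ((⋃ x ∈ Psi k n ∪ Omega k n, geom x) ≃ₜ
      (Metric.sphere (0 : EuclideanSpace ℝ (Fin (k + 1))) 1)) := by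
  have hkn : k < n := by omega
  have hcompact : IsCompact (⋃ x ∈ Psi k n ∪ Omega k n, geom x) :=
    Finset.isCompact_biUnion _ fun x _ => isCompact_geom x
  have := isCompact_iff_compactSpace.1 hcompact
  let e := (Set.BijOn.mk (Set.mapsTo_image _ _) (injOn_momentMap hkn.le)
    (Set.surjOn_image _ _)).equiv (momentMap k n)
  have he : Continuous e :=
    (((momentMap k n).continuous_of_finiteDimensional).comp continuous_subtype_val).subtype_mk _
  obtain ⟨g, -, -, hg⟩ := exists_homeomorph_image_interior_closure_frontier_eq_unitBall
    ((convex_Icc (-1 : Fin n → ℝ) 1).linear_image (momentMap k n))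
    (interior_momentMap_image_nonempty hkn) (isCompact_momentMap_image k n).isBounded
  exact ⟨((Continuous.homeoOfEquivCompactToT2 he).trans
    (Homeomorph.setCongr (momentMap_image_iUnion_geom hkn))).trans
    ((g.image _).trans (Homeomorph.setCongr hg))⟩
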